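/- arXiv:1903.01727 — 2 statements merged into one kernel-verified Lean document; each statement's English description precedes it below -/
import Mathlib

section
/- For each k and 0 ≤ q ≤ k with p = k − q, there is an induced short exact sequence of quotients 0 → (π_q(Z^k) ∩ C^{p,q})/(π_q(B^k) ∩ C^{p,q}) → π_q(Z^k)/π_q(B^k) → π_{q+1}(Z^k)/π_{q+1}(B^k) → 0, and if the ring of scalars is a field, H^k(C,D) ≅ ⊕_{p+q=k} (π_q(Z^k) ∩ C^{p,q})/(π_q(B^k) ∩ C^{p,q}). -/
open DirectSum

variable {R M : Type} [CommRing R] [AddCommGroup M] [Module R M]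

/-- Projection `π_q` of a bigraded module onto the part of second degree `≥ q`,
along the bigrading. -/
noncomputable def bproj (𝒞 : ℤ × ℤ → Submodule R M) [DirectSum.Decomposition 𝒞] (q : ℤ) :
    M →ₗ[R] M :=
  (DirectSum.coeLinearMap 𝒞).comp <|
    (DFinsupp.filterLinearMap R (fun pq : ℤ × ℤ => 𝒞 pq) (fun pq => q ≤ pq.2)).comp
      (DirectSum.decomposeLinearEquiv 𝒞).toLinearMap

/-- The bihomogeneous component of bidegree `(p, q)` of an element. -/
noncomputable def bcomp (𝒞 : ℤ × ℤ → Submodule R M) [DirectSum.Decomposition 𝒞] (p q : ℤ)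
    (x : M) : M :=
  (DirectSum.decompose 𝒞 x (p, q) : M)

/-- The total-degree-`k` part `C^k = ⊕_{p+q=k} C^{p,q}`. -/
def bdeg (𝒞 : ℤ × ℤ → Submodule R M) (k : ℤ) : Submodule R M :=
  ⨆ p : ℤ, 𝒞 (p, k - p)

/-- The part of second degree `q`, `⊕_p C^{p,q}`. -/
def brow (𝒞 : ℤ × ℤ → Submodule R M) (q : ℤ) : Submodule R M :=
  ⨆ p : ℤ, 𝒞 (p, q)

/-- The decreasing column filtration `F^p C = ⊕_{i ≥ p, j} C^{i,j}`. -/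
def bfil (𝒞 : ℤ × ℤ → Submodule R M) (p : ℤ) : Submodule R M :=
  ⨆ (i : ℤ) (_ : p ≤ i) (j : ℤ), 𝒞 (i, j)

section Quotients

variable {R M : Type} [CommRing R] [AddCommGroup M] [Module R M]

/-- If `ψ` factors through `φ`, and `N` cuts out of `φ(Z)` the images of `Z ⊓ ker ψ`, then
`(φ(Z) ⊓ N) / (φ(B) ⊓ N) → φ(Z) / φ(B) → ψ(Z) / ψ(B)` is short exact. -/
theorem exists_shortExact_quotient_map (φ ψ : M →ₗ[R] M) (hψφ : ∀ x, ψ (φ x) = ψ x)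
    (Z B N : Submodule R M) (hBZ : B ≤ Z) (hN : ∀ z ∈ Z, φ z ∈ N ↔ ψ z = 0) :
    ∃ (f : (↥(Submodule.map φ Z ⊓ N) ⧸
          Submodule.comap (Submodule.map φ Z ⊓ N).subtype (Submodule.map φ B ⊓ N)) →ₗ[R]
        (↥(Submodule.map φ Z) ⧸
          Submodule.comap (Submodule.map φ Z).subtype (Submodule.map φ B)))
      (g : (↥(Submodule.map φ Z) ⧸
          Submodule.comap (Submodule.map φ Z).subtype (Submodule.map φ B)) →ₗ[R]
        (↥(Submodule.map ψ Z) ⧸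
          Submodule.comap (Submodule.map ψ Z).subtype (Submodule.map ψ B))),
      Function.Injective f ∧ Function.Surjective g ∧
      LinearMap.range f = LinearMap.ker g ∧
      (∀ (x : M) (hx : x ∈ Submodule.map φ Z ⊓ N) (hx' : x ∈ Submodule.map φ Z),
        f (Submodule.Quotient.mk ⟨x, hx⟩) = Submodule.Quotient.mk ⟨x, hx'⟩) ∧
      (∀ (x : M) (hx : x ∈ Submodule.map φ Z) (hx' : ψ x ∈ Submodule.map ψ Z),
        g (Submodule.Quotient.mk ⟨x, hx⟩) = Submodule.Quotient.mk ⟨ψ x, hx'⟩) := by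
  have hψ : ∀ A : Submodule R M, ∀ x ∈ A.map φ, ψ x ∈ A.map ψ := by
    rintro A _ ⟨z, hz, rfl⟩
    exact ⟨z, hz, (hψφ z).symm⟩
  have hf : Submodule.comap (Submodule.map φ Z ⊓ N).subtype (Submodule.map φ B ⊓ N) ≤
      (Submodule.comap (Submodule.map φ Z).subtype (Submodule.map φ B)).comap
        (Submodule.inclusion inf_le_left) := fun x hx => (Submodule.mem_inf.1 hx).1
  have hg : Submodule.comap (Submodule.map φ Z).subtype (Submodule.map φ B) ≤
      (Submodule.comap (Submodule.map ψ Z).subtype (Submodule.map ψ B)).comap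
        (ψ.restrict (hψ Z)) := fun x hx => hψ B _ hx
  refine ⟨Submodule.mapQ _ _ _ hf, Submodule.mapQ _ _ _ hg, ?_, ?_, ?_,
    fun x hx hx' => rfl, fun x hx hx' => rfl⟩
  · rw [injective_iff_map_eq_zero]
    intro x h
    obtain ⟨x, rfl⟩ := Submodule.Quotient.mk_surjective _ x
    rw [Submodule.mapQ_apply, Submodule.Quotient.mk_eq_zero] at h
    exact (Submodule.Quotient.mk_eq_zero _).2 ⟨h, x.2.2⟩
  · intro y
    obtain ⟨⟨_, z, hz, rfl⟩, rfl⟩ := Submodule.Quotient.mk_surjective _ y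
    refine ⟨Submodule.Quotient.mk ⟨φ z, z, hz, rfl⟩, ?_⟩
    rw [Submodule.mapQ_apply]
    congr 1
    exact Subtype.ext (hψφ z)
  · apply le_antisymm
    · rintro _ ⟨x, rfl⟩
      obtain ⟨⟨_, ⟨z, hz, rfl⟩, hzN⟩, rfl⟩ := Submodule.Quotient.mk_surjective _ x
      rw [LinearMap.mem_ker, Submodule.mapQ_apply, Submodule.mapQ_apply,
        Submodule.Quotient.mk_eq_zero]
      change ψ (φ z) ∈ B.map ψ
      rw [hψφ, (hN z hz).1 hzN]
      exact zero_mem _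
    · intro y hy
      obtain ⟨⟨_, z, hz, rfl⟩, rfl⟩ := Submodule.Quotient.mk_surjective _ y
      rw [LinearMap.mem_ker, Submodule.mapQ_apply, Submodule.Quotient.mk_eq_zero] at hy
      obtain ⟨b, hb, hbz⟩ : ψ (φ z) ∈ B.map ψ := hy
      have hzb : z - b ∈ Z := sub_mem hz (hBZ hb)
      have hzbN : φ (z - b) ∈ N := (hN _ hzb).2 (by rw [map_sub, hbz, hψφ, sub_self])
      refine ⟨Submodule.Quotient.mk ⟨φ (z - b), ⟨z - b, hzb, rfl⟩, hzbN⟩, ?_⟩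
      rw [Submodule.mapQ_apply, Submodule.Quotient.eq]
      refine ⟨-b, neg_mem hb, ?_⟩
      simp [Submodule.inclusion]

end Quotients

section Bigraded

variable {R M : Type} [CommRing R] [AddCommGroup M] [Module R M]
  (𝒞 : ℤ × ℤ → Submodule R M) [DirectSum.Decomposition 𝒞]

theorem decompose_bproj (q : ℤ) (x : M) (i : ℤ × ℤ) :
    decompose 𝒞 (bproj 𝒞 q x) i = if q ≤ i.2 then decompose 𝒞 x i else 0 := by
  have : decompose 𝒞 (bproj 𝒞 q x) =
      DFinsupp.filter (fun pq : ℤ × ℤ => q ≤ pq.2) (decompose 𝒞 x) :=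
    (decompose 𝒞).apply_symm_apply _
  rw [this, DFinsupp.filter_apply]

theorem ext_decompose {x y : M} (h : ∀ i, decompose 𝒞 x i = decompose 𝒞 y i) : x = y :=
  (decompose 𝒞).injective (DFinsupp.ext h)

theorem bproj_bproj_succ (q : ℤ) (x : M) :
    bproj 𝒞 (q + 1) (bproj 𝒞 q x) = bproj 𝒞 (q + 1) x := by
  refine ext_decompose 𝒞 fun i => ?_
  simp only [decompose_bproj]
  split_ifs <;> first | rfl | omega

theorem mem_of_decompose_eq_zero {x : M} {j : ℤ × ℤ}
    (h : ∀ i, i ≠ j → decompose 𝒞 x i = 0) : x ∈ 𝒞 j := by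
  have : x = (decompose 𝒞 x j : M) := by
    refine ext_decompose 𝒞 fun i => ?_
    by_cases hij : i = j
    · subst hij
      rw [decompose_coe, DirectSum.of_eq_same]
    · rw [h i hij, decompose_coe, DirectSum.of_eq_of_ne _ _ _ hij]
  rw [this]
  exact (decompose 𝒞 x j).2

theorem decompose_eq_zero_of_mem {x : M} {i j : ℤ × ℤ} (hx : x ∈ 𝒞 j) (hij : i ≠ j) :
    decompose 𝒞 x i = 0 := by
  rw [decompose_of_mem 𝒞 hx, DirectSum.of_eq_of_ne _ _ _ hij]

theorem decompose_eq_zero_of_mem_bdeg {k : ℤ} {x : M} (hx : x ∈ bdeg 𝒞 k) {i : ℤ × ℤ}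
    (hi : i.1 + i.2 ≠ k) : decompose 𝒞 x i = 0 := by
  induction hx using Submodule.iSup_induction' with
  | mem p x hx =>
    refine decompose_eq_zero_of_mem 𝒞 hx ?_
    rintro rfl
    exact hi (by simp)
  | zero => simp
  | add x y _ _ hx hy => rw [decompose_add, DirectSum.add_apply, hx, hy, add_zero]

theorem bproj_mem_iff_bproj_succ_eq_zero {k : ℤ} {z : M} (hz : z ∈ bdeg 𝒞 k) (q : ℤ) :
    bproj 𝒞 q z ∈ 𝒞 (k - q, q) ↔ bproj 𝒞 (q + 1) z = 0 := by
  constructor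
  · intro h
    refine ext_decompose 𝒞 fun i => ?_
    rw [decompose_zero, DirectSum.zero_apply, decompose_bproj]
    split_ifs with hi
    · have := decompose_eq_zero_of_mem 𝒞 (i := i) h (by rintro rfl; simp at hi)
      rwa [decompose_bproj, if_pos (by omega)] at this
    · rfl
  · intro h
    refine mem_of_decompose_eq_zero 𝒞 fun i hi => ?_
    rw [decompose_bproj]
    split_ifs with hqi
    · by_cases hi' : q + 1 ≤ i.2
      · have : decompose 𝒞 (bproj 𝒞 (q + 1) z) i = 0 := by simp [h]
        rwa [decompose_bproj, if_pos hi'] at this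
      · refine decompose_eq_zero_of_mem_bdeg 𝒞 hz fun hs => hi (Prod.ext ?_ ?_)
        · change i.1 = k - q
          omega
        · change i.2 = q
          omega
    · rfl

theorem decompose_eq_zero_of_eq_bot {i : ℤ × ℤ} (h : 𝒞 i = ⊥) (x : M) :
    decompose 𝒞 x i = 0 := by
  exact Subtype.ext ((Submodule.mem_bot R).1 (h.le (decompose 𝒞 x i).2))

theorem bproj_zero_apply (hfq : ∀ p q : ℤ, p < 0 ∨ q < 0 → 𝒞 (p, q) = ⊥) (x : M) :
    bproj 𝒞 0 x = x := by
  refine ext_decompose 𝒞 fun i => ?_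
  rw [decompose_bproj]
  split_ifs with hi
  · rfl
  · exact (decompose_eq_zero_of_eq_bot 𝒞 (hfq _ _ (Or.inr (not_le.1 hi))) x).symm

theorem bproj_succ_apply_of_mem_bdeg (hfq : ∀ p q : ℤ, p < 0 ∨ q < 0 → 𝒞 (p, q) = ⊥) {k : ℤ}
    {x : M} (hx : x ∈ bdeg 𝒞 k) : bproj 𝒞 (k + 1) x = 0 := by
  refine ext_decompose 𝒞 fun i => ?_
  rw [decompose_bproj, decompose_zero, DirectSum.zero_apply]
  split_ifs with hi
  · by_cases hik : i.1 + i.2 = k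
    · exact decompose_eq_zero_of_eq_bot 𝒞 (hfq _ _ (Or.inl (by omega))) x
    · exact decompose_eq_zero_of_mem_bdeg 𝒞 hx hik
  · rfl

omit [DirectSum.Decomposition 𝒞] in
theorem le_bdeg {p q k : ℤ} (h : p + q = k) : 𝒞 (p, q) ≤ bdeg 𝒞 k := by
  obtain rfl : q = k - p := by omega
  exact le_iSup (fun p => 𝒞 (p, k - p)) p

omit [DirectSum.Decomposition 𝒞] in
theorem map_bdeg_le {D21 D10 D01 : M →ₗ[R] M}
    (h21 : ∀ p q : ℤ, (𝒞 (p, q)).map D21 ≤ 𝒞 (p + 2, q - 1))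
    (h10 : ∀ p q : ℤ, (𝒞 (p, q)).map D10 ≤ 𝒞 (p + 1, q))
    (h01 : ∀ p q : ℤ, (𝒞 (p, q)).map D01 ≤ 𝒞 (p, q + 1)) (k : ℤ) :
    (bdeg 𝒞 (k - 1)).map (D21 + D10 + D01) ≤ bdeg 𝒞 k := by
  rw [bdeg, Submodule.map_iSup]
  refine iSup_le fun p => ?_
  rintro _ ⟨x, hx, rfl⟩
  refine add_mem (add_mem ?_ ?_) ?_
  · exact le_bdeg 𝒞 (by ring) (h21 _ _ (Submodule.mem_map_of_mem hx))
  · exact le_bdeg 𝒞 (by ring) (h10 _ _ (Submodule.mem_map_of_mem hx))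
  · exact le_bdeg 𝒞 (by ring) (h01 _ _ (Submodule.mem_map_of_mem hx))

end Bigraded

section Rank

/-- A recursion `v i = r i + v (i + 1)` with `v` eventually zero computes `v 0` as the total sum
of `r`, provided that `r` is supported in `[0, k]`. -/
theorem Cardinal.eq_sum_of_eq_add_succ (r v : ℤ → Cardinal.{0}) (k : ℤ) (hk : 0 ≤ k)
    (hv : ∀ i, v i = r i + v (i + 1)) (hvk : v (k + 1) = 0)
    (hr : ∀ i, i < 0 ∨ k < i → r i = 0) : v 0 = Cardinal.sum r := by
  have single : ∀ j : ℤ, Cardinal.sum (fun i => if i = j then r i else 0) = r j := by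
    intro j
    have h : ∀ i, (if i = j then r i else 0) = Cardinal.mk {_x : (r j).out // i = j} := by
      intro i
      split_ifs with hij
      · subst hij
        rw [Cardinal.mk_congr (Equiv.subtypeUnivEquiv fun _ => rfl), Cardinal.mk_out]
      · exact (Cardinal.mk_eq_zero_iff.2 ⟨fun x => hij x.2⟩).symm
    simp_rw [h]
    rw [← Cardinal.mk_sigma]
    refine (Cardinal.mk_congr ?_).trans (Cardinal.mk_out (r j))
    exact
      { toFun := fun x => x.2.1
        invFun := fun y => ⟨j, y, rfl⟩
        left_inv := by rintro ⟨i, y, rfl⟩; rfl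
        right_inv := fun _ => rfl }
  have key : ∀ n : ℕ, v (k + 1 - n) =
      Cardinal.sum (fun i => if k + 1 - n ≤ i then r i else 0) := by
    intro n
    induction n with
    | zero =>
      rw [Nat.cast_zero, sub_zero, hvk]
      symm
      rw [show (fun i => if k + 1 ≤ i then r i else 0) = fun _ : ℤ => (0 : Cardinal.{0}) from ?_]
      · simp
      · funext i
        split_ifs with hi
        · exact hr i (Or.inr (by omega))
        · rfl
    | succ n ih =>
      rw [hv, show k + 1 - ((n + 1 : ℕ) : ℤ) + 1 = k + 1 - n by push_cast; ring, ih,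
        ← single (k + 1 - ((n + 1 : ℕ) : ℤ)), ← Cardinal.sum_add_distrib']
      congr 1
      funext i
      split_ifs <;> first | omega | simp
  have h := key (k + 1).toNat
  rw [Int.toNat_of_nonneg (by omega), sub_self] at h
  rw [h]
  congr 1
  funext i
  split_ifs with hi
  · rfl
  · exact (hr i (Or.inl (not_le.1 hi))).symm

end Rank

theorem statement8 {K M : Type} [Field K] [AddCommGroup M] [Module K M]
    (𝒞 : ℤ × ℤ → Submodule K M) [DirectSum.Decomposition 𝒞]
    (hfq : ∀ p q : ℤ, p < 0 ∨ q < 0 → 𝒞 (p, q) = ⊥)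
    (D21 D10 D01 : M →ₗ[K] M)
    (h21 : ∀ p q : ℤ, (𝒞 (p, q)).map D21 ≤ 𝒞 (p + 2, q - 1))
    (h10 : ∀ p q : ℤ, (𝒞 (p, q)).map D10 ≤ 𝒞 (p + 1, q))
    (h01 : ∀ p q : ℤ, (𝒞 (p, q)).map D01 ≤ 𝒞 (p, q + 1))
    (D : M →ₗ[K] M) (hDdef : D = D21 + D10 + D01) (hD : D ∘ₗ D = 0)
    (k p q : ℤ) (hq0 : 0 ≤ q) (hqk : q ≤ k) (hk : p = k - q)
    -- `Zk` : the k-cocycles, `Bk` : the k-coboundaries of (C, D)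
    (Zk Bk : Submodule K M)
    (hZ : Zk = bdeg 𝒞 k ⊓ LinearMap.ker D)
    (hB : Bk = Submodule.map D (bdeg 𝒞 (k - 1))) :
    -- the induced short exact sequence of quotients:
    (∃ (f : (↥(Submodule.map (bproj 𝒞 q) Zk ⊓ 𝒞 (p, q)) ⧸
          Submodule.comap (Submodule.map (bproj 𝒞 q) Zk ⊓ 𝒞 (p, q)).subtype
            (Submodule.map (bproj 𝒞 q) Bk ⊓ 𝒞 (p, q))) →ₗ[K]
        (↥(Submodule.map (bproj 𝒞 q) Zk) ⧸
          Submodule.comap (Submodule.map (bproj 𝒞 q) Zk).subtype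
            (Submodule.map (bproj 𝒞 q) Bk)))
      (g : (↥(Submodule.map (bproj 𝒞 q) Zk) ⧸
          Submodule.comap (Submodule.map (bproj 𝒞 q) Zk).subtype
            (Submodule.map (bproj 𝒞 q) Bk)) →ₗ[K]
        (↥(Submodule.map (bproj 𝒞 (q + 1)) Zk) ⧸
          Submodule.comap (Submodule.map (bproj 𝒞 (q + 1)) Zk).subtype
            (Submodule.map (bproj 𝒞 (q + 1)) Bk))),
      Function.Injective f ∧ Function.Surjective g ∧
      LinearMap.range f = LinearMap.ker g ∧
      -- `f` is induced by the inclusion on representatives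
      (∀ (x : M) (hx : x ∈ Submodule.map (bproj 𝒞 q) Zk ⊓ 𝒞 (p, q))
          (hx' : x ∈ Submodule.map (bproj 𝒞 q) Zk),
        f (Submodule.Quotient.mk ⟨x, hx⟩) = Submodule.Quotient.mk ⟨x, hx'⟩) ∧
      -- `g` is induced by `π_{q+1}` on representatives
      (∀ (x : M) (hx : x ∈ Submodule.map (bproj 𝒞 q) Zk)
          (hx' : bproj 𝒞 (q + 1) x ∈ Submodule.map (bproj 𝒞 (q + 1)) Zk),
        g (Submodule.Quotient.mk ⟨x, hx⟩) =
          Submodule.Quotient.mk ⟨bproj 𝒞 (q + 1) x, hx'⟩)) ∧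
    -- over a field, H^k(C,D) splits as the direct sum of the subquotients
    Nonempty ((↥Zk ⧸ Submodule.comap Zk.subtype Bk) ≃ₗ[K]
      ⨁ q' : ℤ, (↥(Submodule.map (bproj 𝒞 q') Zk ⊓ 𝒞 (k - q', q')) ⧸
        Submodule.comap (Submodule.map (bproj 𝒞 q') Zk ⊓ 𝒞 (k - q', q')).subtype
          (Submodule.map (bproj 𝒞 q') Bk ⊓ 𝒞 (k - q', q')))) := by
  subst hk
  have hBZ : Bk ≤ Zk := by
    rw [hB, hZ]
    refine le_inf (hDdef ▸ map_bdeg_le 𝒞 h21 h10 h01 k) ?_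
    rintro _ ⟨x, -, rfl⟩
    exact LinearMap.congr_fun hD x
  have hZdeg : ∀ z ∈ Zk, z ∈ bdeg 𝒞 k := fun z hz => (hZ ▸ hz : z ∈ bdeg 𝒞 k ⊓ _).1
  have exact_seq := fun q : ℤ => exists_shortExact_quotient_map (bproj 𝒞 q) (bproj 𝒞 (q + 1))
    (bproj_bproj_succ 𝒞 q) Zk Bk (𝒞 (k - q, q)) hBZ
    fun z hz => bproj_mem_iff_bproj_succ_eq_zero 𝒞 (hZdeg z hz) q
  refine ⟨exact_seq q, ?_⟩
  have bproj_zero : bproj 𝒞 0 = LinearMap.id := LinearMap.ext (bproj_zero_apply 𝒞 hfq)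
  have rank_zero : Module.rank K (↥Zk ⧸ Submodule.comap Zk.subtype Bk) =
      Module.rank K (↥(Submodule.map (bproj 𝒞 0) Zk) ⧸
        Submodule.comap (Submodule.map (bproj 𝒞 0) Zk).subtype (Submodule.map (bproj 𝒞 0) Bk)) := by
    rw [bproj_zero, Submodule.map_id, Submodule.map_id]
  refine Module.nonempty_linearEquiv_iff_rank_eq.2 ?_
  rw [rank_zero, rank_directSum]
  refine Cardinal.eq_sum_of_eq_add_succ _
    (fun i => Module.rank K (↥(Submodule.map (bproj 𝒞 i) Zk) ⧸
      Submodule.comap (Submodule.map (bproj 𝒞 i) Zk).subtype (Submodule.map (bproj 𝒞 i) Bk)))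
    k (hq0.trans hqk) (fun i => ?_) ?_ (fun i hi => ?_)
  · obtain ⟨f, g, hf, hg, hfg, -, -⟩ := exact_seq i
    rw [LinearMap.rank_eq_of_surjective hg, ← hfg, rank_range_of_injective f hf, add_comm]
  · have : Submodule.map (bproj 𝒞 (k + 1)) Zk = ⊥ := by
      rw [eq_bot_iff]
      rintro _ ⟨z, hz, rfl⟩
      exact bproj_succ_apply_of_mem_bdeg 𝒞 hfq (hZdeg z hz)
    rw [this]
    exact rank_subsingleton' _ _
  · have : 𝒞 (k - i, i) = ⊥ := hfq _ _ (by omega)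
    rw [this, inf_bot_eq]
    exact rank_subsingleton' _ _
end

section
/- A Poisson vector field Y = a₁Z₁ + a₂Z₂ of P = ‖y‖² ∂₁∧∂₂ on R² (with L_{Z₁}a₁ + L_{Z₂}a₂ = 0) is Hamiltonian if and only if a₁(0) = a₂(0) = 0; in that case h(y) := ∫₀^∞ a₂(e^{−t}y) dt is a smooth Hamiltonian for Y, i.e., Y = P♯dh, which satisfies L_{Z₁}h = a₂ and L_{Z₂}h = −a₁. Consequently the first Poisson cohomology of (R², P) is two-dimensional: H¹(R², P) = R·[Z₁] ⊕ R·[Z₂]. -/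
/-- The divergence of a vector field on `ℝ²` (with respect to `dy₁ ∧ dy₂`). -/
noncomputable def divg (Y : ℝ × ℝ → ℝ × ℝ) (y : ℝ × ℝ) : ℝ :=
  (fderiv ℝ Y y (1, 0)).1 + (fderiv ℝ Y y (0, 1)).2

/-- The coefficient of the Lie derivative `L_Y (f ∂₁ ∧ ∂₂)` with respect to
`∂₁ ∧ ∂₂`, in coordinates. -/
noncomputable def lieBiv (Y : ℝ × ℝ → ℝ × ℝ) (f : ℝ × ℝ → ℝ) (y : ℝ × ℝ) : ℝ :=
  fderiv ℝ f y (Y y) - f y * divg Y y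

/-- The Lie derivative `L_Z a` of a function along a vector field on `ℝ²`. -/
noncomputable def lieSc (Z : ℝ × ℝ → ℝ × ℝ) (a : ℝ × ℝ → ℝ) (y : ℝ × ℝ) : ℝ :=
  fderiv ℝ a y (Z y)

/-- The Euler vector field `Z₁ = y₁∂₁ + y₂∂₂`. -/
def eulerVF : ℝ × ℝ → ℝ × ℝ := fun y => y

/-- The rotational vector field `Z₂ = −y₂∂₁ + y₁∂₂`. -/
def rotVF : ℝ × ℝ → ℝ × ℝ := fun y => (-y.2, y.1)

/-- The Hamiltonian vector field `P♯dh = ‖y‖² (−∂₂h ∂₁ + ∂₁h ∂₂)` of `h` with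
respect to the Poisson structure `P = ‖y‖² ∂₁ ∧ ∂₂`. -/
noncomputable def ham (h : ℝ × ℝ → ℝ) (y : ℝ × ℝ) : ℝ × ℝ :=
  (y.1 ^ 2 + y.2 ^ 2) • (-(fderiv ℝ h y (0, 1)), fderiv ℝ h y (1, 0))

/-- The candidate Hamiltonian `h(y) := ∫₀^∞ a₂(e^{−t} y) dt`. -/
noncomputable def hamInt (a₂ : ℝ × ℝ → ℝ) (y : ℝ × ℝ) : ℝ :=
  ∫ t in Set.Ioi (0 : ℝ), a₂ (Real.exp (-t) • y)

open Set MeasureTheory Topology in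
/-- Differentiation under the integral sign for a jointly `C¹` integrand on `[0, 1]`. -/
theorem hasFDerivAt_integral_unitInterval {E F : Type*} [NormedAddCommGroup E] [NormedSpace ℝ E]
    [ProperSpace E] [NormedAddCommGroup F] [NormedSpace ℝ F] {f : E × ℝ → F}
    (hf : ContDiff ℝ 1 f) (x : E) :
    HasFDerivAt (fun x => ∫ s in (0 : ℝ)..1, f (x, s))
      (∫ s in (0 : ℝ)..1, (fderiv ℝ f (x, s)).comp (ContinuousLinearMap.inl ℝ E ℝ)) x := by
  have hcont : Continuous fun p : E × ℝ => (fderiv ℝ f p).comp (ContinuousLinearMap.inl ℝ E ℝ) :=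
    (hf.continuous_fderiv one_ne_zero).clm_comp continuous_const
  obtain ⟨C, hC⟩ := ((isCompact_closedBall x 1).prod isCompact_Icc
    (s := Metric.closedBall x 1) (t := Icc (0 : ℝ) 1)).exists_bound_of_continuousOn
      hcont.continuousOn
  have hslice (x : E) : Continuous fun s : ℝ => f (x, s) :=
    hf.continuous.comp (by fun_prop)
  refine intervalIntegral.hasFDerivAt_integral_of_dominated_of_fderiv_le
    (F := fun x s => f (x, s))
    (F' := fun x s => (fderiv ℝ f (x, s)).comp (ContinuousLinearMap.inl ℝ E ℝ))
    (bound := fun _ => C)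
    (Metric.closedBall_mem_nhds x one_pos)
    (Filter.Eventually.of_forall fun x => (hslice x).aestronglyMeasurable)
    ((hslice x).intervalIntegrable _ _)
    (hcont.comp (by fun_prop : Continuous fun s : ℝ => (x, s))).aestronglyMeasurable
    (Filter.Eventually.of_forall fun s hs z hz => hC (z, s) ⟨hz, ?_⟩)
    intervalIntegrable_const
    (Filter.Eventually.of_forall fun s _ z _ => ?_)
  · rw [uIoc_of_le zero_le_one] at hs
    exact ⟨hs.1.le, hs.2⟩
  · exact ((hf.differentiable one_ne_zero (z, s)).hasFDerivAt).comp z (hasFDerivAt_prodMk_left z s)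

universe u in
theorem contDiff_nat_integral_unitInterval {E : Type u} [NormedAddCommGroup E] [NormedSpace ℝ E]
    [ProperSpace E] (n : ℕ) : ∀ {F : Type u} [NormedAddCommGroup F] [NormedSpace ℝ F]
    {f : E × ℝ → F}, ContDiff ℝ (⊤ : ℕ∞) f →
      ContDiff ℝ n fun x => ∫ s in (0 : ℝ)..1, f (x, s) := by
  induction n with
  | zero =>
    intro F _ _ f hf
    exact contDiff_zero.2 (continuous_iff_continuousAt.2 fun x =>
      (hasFDerivAt_integral_unitInterval (hf.of_le (by simp)) x).continuousAt)
  | succ n ih =>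
    intro F _ _ f hf
    have hderiv := hasFDerivAt_integral_unitInterval (f := f) (hf.of_le (by simp))
    rw [Nat.cast_succ, contDiff_succ_iff_fderiv]
    refine ⟨fun x => (hderiv x).differentiableAt, by simp, ?_⟩
    rw [funext fun x => (hderiv x).fderiv]
    exact ih (f := fun p => (fderiv ℝ f p).comp (ContinuousLinearMap.inl ℝ E ℝ))
      ((hf.fderiv_right (by simp)).clm_comp contDiff_const)

universe u in
/-- The integral over `[0, 1]` of a jointly smooth function depends smoothly on the parameter. -/
theorem contDiff_integral_unitInterval {E F : Type u} [NormedAddCommGroup E] [NormedSpace ℝ E]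
    [ProperSpace E] [NormedAddCommGroup F] [NormedSpace ℝ F] {f : E × ℝ → F}
    (hf : ContDiff ℝ (⊤ : ℕ∞) f) :
    ContDiff ℝ (⊤ : ℕ∞) fun x => ∫ s in (0 : ℝ)..1, f (x, s) :=
  contDiff_infty.2 fun n => contDiff_nat_integral_unitInterval n hf

theorem integral_fderiv_segment {E : Type*} [NormedAddCommGroup E] [NormedSpace ℝ E]
    {f : E → ℝ} (hf : ContDiff ℝ 1 f) (p v : E) :
    ∫ s in (0 : ℝ)..1, fderiv ℝ f (p + s • v) v = f (p + v) - f p := by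
  have hderiv (s : ℝ) : HasDerivAt (fun s : ℝ => f (p + s • v)) (fderiv ℝ f (p + s • v) v) s := by
    have hline : HasDerivAt (fun s : ℝ => p + s • v) v s := by
      simpa using ((hasDerivAt_id s).smul_const v).const_add p
    exact (hf.differentiable one_ne_zero _).hasFDerivAt.comp_hasDerivAt s hline
  have hcont : Continuous fun s : ℝ => fderiv ℝ f (p + s • v) v :=
    ((hf.continuous_fderiv one_ne_zero).comp (by fun_prop)).clm_apply continuous_const
  rw [intervalIntegral.integral_eq_sub_of_hasDerivAt (fun s _ => hderiv s)
    (hcont.intervalIntegrable _ _)]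
  simp

/-- Hadamard's lemma along the first coordinate. -/
theorem exists_smooth_eq_fst_mul {f : ℝ × ℝ → ℝ} (hf : ContDiff ℝ (⊤ : ℕ∞) f)
    (h0 : ∀ t, f (0, t) = 0) :
    ∃ b : ℝ × ℝ → ℝ, ContDiff ℝ (⊤ : ℕ∞) b ∧ ∀ y, f y = y.1 * b y := by
  refine ⟨fun y => ∫ s in (0 : ℝ)..1, fderiv ℝ f (s * y.1, y.2) (1, 0), ?_, fun y => ?_⟩
  · refine contDiff_integral_unitInterval
      (f := fun p : (ℝ × ℝ) × ℝ => fderiv ℝ f (p.2 * p.1.1, p.1.2) (1, 0)) ?_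
    exact ((hf.fderiv_right (m := (⊤ : ℕ∞)) (by simp)).comp (by fun_prop)).clm_apply
      contDiff_const
  · have h := integral_fderiv_segment (hf.of_le (by simp)) (0, y.2) (y.1, 0)
    have hpt (s : ℝ) : fderiv ℝ f ((0, y.2) + s • (y.1, 0)) (y.1, 0)
        = y.1 * fderiv ℝ f (s * y.1, y.2) (1, 0) := by
      rw [show ((y.1, 0) : ℝ × ℝ) = y.1 • (1, 0) by simp, map_smul]
      simp
    simp only [hpt, intervalIntegral.integral_const_mul] at h
    simpa [h0] using h.symm

/-- For a smooth function `a` with `a 0 = 0`, the quotient `a (s • y) / s` extends smoothly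
across `s = 0`. -/
theorem exists_smooth_ray_quotient {a : ℝ × ℝ → ℝ} (ha : ContDiff ℝ (⊤ : ℕ∞) a) (h0 : a 0 = 0) :
    ∃ k : (ℝ × ℝ) × ℝ → ℝ, ContDiff ℝ (⊤ : ℕ∞) k ∧ ∀ y s, a (s • y) = s * k (y, s) := by
  refine ⟨fun p => (∫ u in (0 : ℝ)..1, fderiv ℝ a (u • p.2 • p.1) p.1), ?_, fun y s => ?_⟩
  · have hG := contDiff_integral_unitInterval
      (f := fun q : ((ℝ × ℝ) × ℝ) × ℝ => fderiv ℝ a (q.2 • q.1.2 • q.1.1) q.1.1)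
      (((ha.fderiv_right (m := (⊤ : ℕ∞)) (by simp)).comp (by fun_prop)).clm_apply (by fun_prop))
    exact hG
  · have h := integral_fderiv_segment (ha.of_le (by simp)) 0 (s • y)
    simp only [zero_add, h0, sub_zero] at h
    rw [← h, ← intervalIntegral.integral_const_mul]
    simp

open Set MeasureTheory in
theorem hamInt_eq_integral_ray_quotient {a : ℝ × ℝ → ℝ} {k : (ℝ × ℝ) × ℝ → ℝ}
    (hk : ∀ y s, a (s • y) = s * k (y, s)) (y : ℝ × ℝ) :
    hamInt a y = ∫ s in (0 : ℝ)..1, k (y, s) := by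
  have himage : (fun t : ℝ => Real.exp (-t)) '' Ioi 0 = Ioo 0 1 := by
    ext s
    constructor
    · rintro ⟨t, ht, rfl⟩
      exact ⟨Real.exp_pos _, by simpa using ht⟩
    · rintro ⟨h0, h1⟩
      exact ⟨-Real.log s, neg_pos.2 (Real.log_neg h0 h1), by simp [Real.exp_log h0]⟩
  have hchange := integral_image_eq_integral_abs_deriv_smul (s := Ioi (0 : ℝ))
    (f := fun t => Real.exp (-t)) (f' := fun t => -Real.exp (-t)) measurableSet_Ioi
    (fun t _ => by simpa using ((hasDerivAt_neg t).exp).hasDerivWithinAt)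
    (fun t _ s _ h => by simpa using h) (fun s => k (y, s))
  rw [himage] at hchange
  rw [intervalIntegral.integral_of_le zero_le_one, integral_Ioc_eq_integral_Ioo, hchange, hamInt]
  refine setIntegral_congr_fun measurableSet_Ioi fun t _ => ?_
  simp [hk, abs_of_pos (Real.exp_pos _)]

/-- Properties of the candidate Hamiltonian. -/
theorem hamInt_spec {a₁ a₂ : ℝ × ℝ → ℝ} (h₁ : ContDiff ℝ (⊤ : ℕ∞) a₁)
    (h₂ : ContDiff ℝ (⊤ : ℕ∞) a₂) (hdiv : ∀ y, lieSc eulerVF a₁ y + lieSc rotVF a₂ y = 0)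
    (h₁0 : a₁ 0 = 0) (h₂0 : a₂ 0 = 0) :
    ContDiff ℝ (⊤ : ℕ∞) (hamInt a₂) ∧
      (∀ y, lieSc eulerVF (hamInt a₂) y = a₂ y) ∧
      (∀ y, lieSc rotVF (hamInt a₂) y = -a₁ y) := by
  obtain ⟨k, hk, hka⟩ := exists_smooth_ray_quotient h₂ h₂0
  have heq : hamInt a₂ = fun y => ∫ s in (0 : ℝ)..1, k (y, s) :=
    funext (hamInt_eq_integral_ray_quotient hka)
  have hk1 : ContDiff ℝ 1 k := hk.of_le (by simp)
  have h₁1 : ContDiff ℝ 1 a₁ := h₁.of_le (by simp)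
  have hfd : Continuous fun p : (ℝ × ℝ) × ℝ =>
      (fderiv ℝ k p).comp (ContinuousLinearMap.inl ℝ (ℝ × ℝ) ℝ) :=
    (hk1.continuous_fderiv one_ne_zero).clm_comp continuous_const
  have hderiv (y v : ℝ × ℝ) : fderiv ℝ (hamInt a₂) y v
      = ∫ s in (0 : ℝ)..1, fderiv ℝ k (y, s) (v, 0) := by
    have hslice : Continuous fun s : ℝ =>
        (fderiv ℝ k (y, s)).comp (ContinuousLinearMap.inl ℝ (ℝ × ℝ) ℝ) :=
      hfd.comp (by fun_prop : Continuous fun s : ℝ => (y, s))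
    rw [heq, (hasFDerivAt_integral_unitInterval hk1 y).fderiv,
      ContinuousLinearMap.intervalIntegral_apply (hslice.intervalIntegrable _ _)]
    simp
  have hkderiv (y v : ℝ × ℝ) (s : ℝ) (hs : s ≠ 0) :
      fderiv ℝ k (y, s) (v, 0) = fderiv ℝ a₂ (s • y) v := by
    have e₁ : HasFDerivAt (fun z : ℝ × ℝ => s * k (z, s))
        (s • (fderiv ℝ k (y, s)).comp (ContinuousLinearMap.inl ℝ (ℝ × ℝ) ℝ)) y :=
      (((hk1.differentiable one_ne_zero (y, s)).hasFDerivAt).comp y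
        (hasFDerivAt_prodMk_left y s)).const_mul s
    have e₂ : HasFDerivAt (fun z : ℝ × ℝ => a₂ (s • z))
        ((fderiv ℝ a₂ (s • y)).comp (s • ContinuousLinearMap.id ℝ (ℝ × ℝ))) y :=
      ((h₂.differentiable (by simp) (s • y)).hasFDerivAt).comp y ((hasFDerivAt_id y).const_smul s)
    simp only [hka] at e₂
    have h := DFunLike.congr_fun (e₁.unique e₂) v
    simp only [smul_apply, ContinuousLinearMap.comp_apply,
      ContinuousLinearMap.inl_apply, ContinuousLinearMap.id_apply, map_smul, smul_eq_mul] at h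
    exact mul_left_cancel₀ hs h
  have hae (y v : ℝ × ℝ) : fderiv ℝ (hamInt a₂) y v
      = ∫ s in (0 : ℝ)..1, fderiv ℝ a₂ (s • y) v := by
    rw [hderiv]
    refine intervalIntegral.integral_congr_ae (Filter.Eventually.of_forall fun s hs => ?_)
    rw [Set.uIoc_of_le zero_le_one] at hs
    exact hkderiv y v s hs.1.ne'
  refine ⟨heq ▸ contDiff_integral_unitInterval hk, fun y => ?_, fun y => ?_⟩
  · have h := integral_fderiv_segment (h₂.of_le (by simp)) 0 y
    simpa [lieSc, eulerVF, hae, h₂0] using h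
  · have h := integral_fderiv_segment h₁1 0 y
    simp only [zero_add, h₁0, sub_zero] at h
    rw [lieSc, hae, ← h, ← intervalIntegral.integral_neg]
    refine intervalIntegral.integral_congr_ae (Filter.Eventually.of_forall fun s hs => ?_)
    rw [Set.uIoc_of_le zero_le_one] at hs
    have hd := hdiv (s • y)
    have hrot : rotVF (s • y) = s • rotVF y := by simp [rotVF]
    rw [lieSc, lieSc, hrot, eulerVF, map_smul, map_smul, ← smul_add, smul_eq_zero] at hd
    have := hd.resolve_left hs.1.ne'
    linarith

theorem fderiv_apply_eq_coords (h : ℝ × ℝ → ℝ) (y v : ℝ × ℝ) :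
    fderiv ℝ h y v = v.1 * fderiv ℝ h y (1, 0) + v.2 * fderiv ℝ h y (0, 1) := by
  conv_lhs => rw [show v = v.1 • ((1, 0) : ℝ × ℝ) + v.2 • (0, 1) by ext <;> simp]
  rw [map_add, map_smul, map_smul, smul_eq_mul, smul_eq_mul]

theorem eq_ham_of_lieSc {a₁ a₂ h : ℝ × ℝ → ℝ} {y : ℝ × ℝ} (he : lieSc eulerVF h y = a₂ y)
    (hr : lieSc rotVF h y = -a₁ y) : a₁ y • eulerVF y + a₂ y • rotVF y = ham h y := by
  rw [lieSc, fderiv_apply_eq_coords] at he hr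
  simp only [eulerVF, rotVF] at he hr
  have hr' : a₁ y = y.2 * fderiv ℝ h y (1, 0) - y.1 * fderiv ℝ h y (0, 1) := by linarith
  rw [hr', ← he]
  ext <;> simp [eulerVF, rotVF, ham] <;> ring

/-- The components of a Hamiltonian vector field in the frame `Z₁, Z₂` vanish at the origin. -/
theorem coeff_zero_of_eq_ham {a₁ a₂ h : ℝ × ℝ → ℝ} (h₁ : Continuous a₁) (h₂ : Continuous a₂)
    (hh : ContDiff ℝ (⊤ : ℕ∞) h) (heq : ∀ y, a₁ y • eulerVF y + a₂ y • rotVF y = ham h y) :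
    a₁ 0 = 0 ∧ a₂ 0 = 0 := by
  have hc (v : ℝ × ℝ) : Continuous fun y => fderiv ℝ h y v :=
    (hh.continuous_fderiv (by simp)).clm_apply continuous_const
  have hp := hc (1, 0)
  have hq := hc (0, 1)
  have key (y : ℝ × ℝ) (hy : y ∈ ({0}ᶜ : Set (ℝ × ℝ))) :
      a₁ y = y.2 * fderiv ℝ h y (1, 0) - y.1 * fderiv ℝ h y (0, 1) ∧
      a₂ y = y.1 * fderiv ℝ h y (1, 0) + y.2 * fderiv ℝ h y (0, 1) := by
    have hr : y.1 ^ 2 + y.2 ^ 2 ≠ 0 := fun h0 => hy <| by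
      have e₁ : y.1 = 0 := by nlinarith [sq_nonneg y.1, sq_nonneg y.2]
      have e₂ : y.2 = 0 := by nlinarith [sq_nonneg y.1, sq_nonneg y.2]
      exact Prod.ext e₁ e₂
    have e₁ := congrArg Prod.fst (heq y)
    have e₂ := congrArg Prod.snd (heq y)
    simp only [eulerVF, rotVF, ham, Prod.fst_add, Prod.snd_add, Prod.smul_fst, Prod.smul_snd,
      smul_eq_mul] at e₁ e₂
    constructor <;> apply mul_left_cancel₀ hr
    · linear_combination y.1 * e₁ + y.2 * e₂
    · linear_combination -y.2 * e₁ + y.1 * e₂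
  have hd : Dense ({0}ᶜ : Set (ℝ × ℝ)) := dense_compl_singleton 0
  have k₁ := congrFun (h₁.ext_on hd (by fun_prop) fun y hy => (key y hy).1) 0
  have k₂ := congrFun (h₂.ext_on hd (by fun_prop) fun y hy => (key y hy).2) 0
  exact ⟨by simpa using k₁, by simpa using k₂⟩

theorem divg_frame {a₁ a₂ : ℝ × ℝ → ℝ} {y : ℝ × ℝ} (h₁ : DifferentiableAt ℝ a₁ y)
    (h₂ : DifferentiableAt ℝ a₂ y) :
    divg (fun y => a₁ y • eulerVF y + a₂ y • rotVF y) y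
      = 2 * a₁ y + (lieSc eulerVF a₁ y + lieSc rotVF a₂ y) := by
  have hrot : HasFDerivAt rotVF ((-ContinuousLinearMap.snd ℝ ℝ ℝ).prod
      (ContinuousLinearMap.fst ℝ ℝ ℝ)) y := hasFDerivAt_snd.neg.prodMk hasFDerivAt_fst
  have hY := (h₁.hasFDerivAt.smul (hasFDerivAt_id y)).add (h₂.hasFDerivAt.smul hrot)
  have hY' : fderiv ℝ (fun y => a₁ y • eulerVF y + a₂ y • rotVF y) y = _ := hY.fderiv
  rw [divg, hY', lieSc, lieSc, fderiv_apply_eq_coords a₁ y (eulerVF y),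
    fderiv_apply_eq_coords a₂ y (rotVF y)]
  simp [eulerVF, rotVF]
  ring

/-- Every Poisson vector field of `‖y‖² ∂₁ ∧ ∂₂` is a smooth combination of `Z₁, Z₂`. -/
theorem exists_frame_coeffs {Y : ℝ × ℝ → ℝ × ℝ} (hY : ContDiff ℝ (⊤ : ℕ∞) Y)
    (hP : ∀ y, lieBiv Y (fun y => y.1 ^ 2 + y.2 ^ 2) y = 0) :
    ∃ a₁ a₂ : ℝ × ℝ → ℝ, ContDiff ℝ (⊤ : ℕ∞) a₁ ∧ ContDiff ℝ (⊤ : ℕ∞) a₂ ∧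
      (∀ y, lieSc eulerVF a₁ y + lieSc rotVF a₂ y = 0) ∧
      ∀ y, Y y = a₁ y • eulerVF y + a₂ y • rotVF y := by
  set a : ℝ × ℝ → ℝ := fun y => divg Y y / 2 with ha_def
  have hfd (v : ℝ × ℝ) : ContDiff ℝ (⊤ : ℕ∞) fun y => fderiv ℝ Y y v :=
    (hY.fderiv_right (by simp)).clm_apply contDiff_const
  have ha : ContDiff ℝ (⊤ : ℕ∞) a :=
    ((contDiff_fst.comp (hfd (1, 0))).add (contDiff_snd.comp (hfd (0, 1)))).div_const 2
  have hdot (y : ℝ × ℝ) : y.1 * (Y y).1 + y.2 * (Y y).2 = (y.1 ^ 2 + y.2 ^ 2) * a y := by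
    have hsq : HasFDerivAt (fun y : ℝ × ℝ => y.1 ^ 2 + y.2 ^ 2) _ y :=
      ((hasFDerivAt_fst (𝕜 := ℝ) (p := y)).pow 2).add ((hasFDerivAt_snd (𝕜 := ℝ) (p := y)).pow 2)
    have h := hP y
    rw [lieBiv, hsq.fderiv] at h
    simp at h
    simp only [ha_def]
    linarith
  have hY₁ : Continuous fun y => (Y y).1 := continuous_fst.comp hY.continuous
  have hY₂ : Continuous fun y => (Y y).2 := continuous_snd.comp hY.continuous
  have hac := ha.continuous
  have hW : ∀ t : ℝ, (Y (0, t)).2 - t * a (0, t) = 0 := by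
    have hslice : Continuous fun t : ℝ => ((0, t) : ℝ × ℝ) := by fun_prop
    have hc : Continuous fun t : ℝ => (Y (0, t)).2 - t * a (0, t) :=
      (hY₂.comp hslice).sub (continuous_id.mul (hac.comp hslice))
    refine fun t => congrFun (hc.ext_on (dense_compl_singleton (0 : ℝ)) continuous_const ?_) t
    intro t ht
    have h := hdot (0, t)
    refine mul_left_cancel₀ (show t ≠ 0 from ht) ?_
    simp only at h
    linarith
  obtain ⟨b, hb, hWb⟩ := exists_smooth_eq_fst_mul (f := fun y => (Y y).2 - y.2 * a y)
    ((contDiff_snd.comp hY).sub (contDiff_snd.mul ha)) hW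
  have hbc := hb.continuous
  have hfst : ∀ y, (Y y).1 = a y * y.1 - b y * y.2 := by
    have hd : Dense {y : ℝ × ℝ | y.1 ≠ 0} :=
      (dense_compl_singleton (0 : ℝ)).preimage isOpenMap_fst
    refine fun y => congrFun (hY₁.ext_on hd
      (show Continuous fun y : ℝ × ℝ => a y * y.1 - b y * y.2 by fun_prop) fun y hy => ?_) y
    refine mul_left_cancel₀ (show y.1 ≠ 0 from hy) ?_
    linear_combination hdot y - y.2 * hWb y
  have hframe (y : ℝ × ℝ) : Y y = a y • eulerVF y + b y • rotVF y := by
    have h₂ := hWb y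
    ext
    · simp only [eulerVF, rotVF, Prod.fst_add, Prod.smul_fst, smul_eq_mul]
      linarith [hfst y]
    · simp only [eulerVF, rotVF, Prod.snd_add, Prod.smul_snd, smul_eq_mul]
      linarith
  refine ⟨a, b, ha, hb, fun y => ?_, hframe⟩
  have hdivg := divg_frame (ha.differentiable (by simp) y) (hb.differentiable (by simp) y)
  rw [← funext hframe] at hdivg
  simp only [ha_def] at hdivg ⊢
  linarith

theorem statement19 :
    (∀ a₁ a₂ : ℝ × ℝ → ℝ, ContDiff ℝ (⊤ : ℕ∞) a₁ → ContDiff ℝ (⊤ : ℕ∞) a₂ →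
      (∀ y, lieSc eulerVF a₁ y + lieSc rotVF a₂ y = 0) →
      -- `Y = a₁Z₁ + a₂Z₂` is Hamiltonian iff `a₁(0) = a₂(0) = 0`
      (((∃ h : ℝ × ℝ → ℝ, ContDiff ℝ (⊤ : ℕ∞) h ∧
          ∀ y, a₁ y • eulerVF y + a₂ y • rotVF y = ham h y) ↔
        (a₁ 0 = 0 ∧ a₂ 0 = 0)) ∧
      -- in that case `h(y) = ∫₀^∞ a₂(e^{−t}y)dt` is a smooth Hamiltonian for `Y`
      -- satisfying `L_{Z₁}h = a₂` and `L_{Z₂}h = −a₁`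
      (a₁ 0 = 0 → a₂ 0 = 0 →
        ContDiff ℝ (⊤ : ℕ∞) (hamInt a₂) ∧
        (∀ y, a₁ y • eulerVF y + a₂ y • rotVF y = ham (hamInt a₂) y) ∧
        (∀ y, lieSc eulerVF (hamInt a₂) y = a₂ y) ∧
        (∀ y, lieSc rotVF (hamInt a₂) y = -a₁ y)))) ∧
    -- consequently `H¹(ℝ², P) = ℝ·[Z₁] ⊕ ℝ·[Z₂]` : every Poisson vector field is,
    -- uniquely modulo Hamiltonian vector fields, a constant combination of Z₁, Z₂
    (∀ Y : ℝ × ℝ → ℝ × ℝ, ContDiff ℝ (⊤ : ℕ∞) Y →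
      (∀ y, lieBiv Y (fun y => y.1 ^ 2 + y.2 ^ 2) y = 0) →
      ∃! c : ℝ × ℝ, ∃ h : ℝ × ℝ → ℝ, ContDiff ℝ (⊤ : ℕ∞) h ∧
        ∀ y, Y y = c.1 • eulerVF y + c.2 • rotVF y + ham h y) := by
  have hpart : ∀ a₁ a₂ : ℝ × ℝ → ℝ, ContDiff ℝ (⊤ : ℕ∞) a₁ → ContDiff ℝ (⊤ : ℕ∞) a₂ →
      (∀ y, lieSc eulerVF a₁ y + lieSc rotVF a₂ y = 0) → a₁ 0 = 0 → a₂ 0 = 0 →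
        ContDiff ℝ (⊤ : ℕ∞) (hamInt a₂) ∧
        (∀ y, a₁ y • eulerVF y + a₂ y • rotVF y = ham (hamInt a₂) y) ∧
        (∀ y, lieSc eulerVF (hamInt a₂) y = a₂ y) ∧
        (∀ y, lieSc rotVF (hamInt a₂) y = -a₁ y) := by
    intro a₁ a₂ h₁ h₂ hdiv h₁0 h₂0
    obtain ⟨hs, he, hr⟩ := hamInt_spec h₁ h₂ hdiv h₁0 h₂0
    exact ⟨hs, fun y => eq_ham_of_lieSc (he y) (hr y), he, hr⟩
  refine ⟨fun a₁ a₂ h₁ h₂ hdiv => ⟨⟨?_, ?_⟩, hpart a₁ a₂ h₁ h₂ hdiv⟩, fun Y hY hP => ?_⟩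
  · rintro ⟨h, hh, heq⟩
    exact coeff_zero_of_eq_ham h₁.continuous h₂.continuous hh heq
  · rintro ⟨h₁0, h₂0⟩
    obtain ⟨hs, heq, -⟩ := hpart a₁ a₂ h₁ h₂ hdiv h₁0 h₂0
    exact ⟨_, hs, heq⟩
  · obtain ⟨a₁, a₂, h₁, h₂, hdiv, hframe⟩ := exists_frame_coeffs hY hP
    have hsub (c : ℝ × ℝ) (h : ℝ × ℝ → ℝ) (y : ℝ × ℝ) :
        Y y = c.1 • eulerVF y + c.2 • rotVF y + ham h y ↔
          (a₁ y - c.1) • eulerVF y + (a₂ y - c.2) • rotVF y = ham h y := by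
      rw [hframe, ← sub_eq_iff_eq_add', sub_smul, sub_smul, add_sub_add_comm]
    simp only [hsub]
    refine ⟨(a₁ 0, a₂ 0), ?_, ?_⟩
    · obtain ⟨hs, heq, -⟩ := hpart (fun y => a₁ y - a₁ 0) (fun y => a₂ y - a₂ 0)
        (h₁.sub contDiff_const) (h₂.sub contDiff_const)
        (fun y => by simpa [lieSc, fderiv_sub_const] using hdiv y) (sub_self _) (sub_self _)
      exact ⟨_, hs, heq⟩
    · rintro c ⟨h, hh, heq⟩
      obtain ⟨e₁, e₂⟩ := coeff_zero_of_eq_ham (a₁ := fun y => a₁ y - c.1)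
        (a₂ := fun y => a₂ y - c.2) (h₁.continuous.sub continuous_const)
        (h₂.continuous.sub continuous_const) hh heq
      exact Prod.ext (sub_eq_zero.1 e₁).symm (sub_eq_zero.1 e₂).symm
end
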